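/- Let ψ = (ψ1,ψ0): (g: G1 → G0) → (h: H1 → H0) be an admissible epic in Mon(ω,𝒢), i.e. ψ1 and ψ0 are surjective and the induced map on componentwise kernels is an object of Mon(ω,𝒢), and let θ = (θ1,θ0): (t: T1 → T0) → (h: H1 → H0) be an arbitrary morphism in Mon(ω,𝒢). For i = 0,1 let E_i = G_i ×_{H_i} T_i be the pullback of ψ_i along θ_i and let e: E1 → E0 be the induced map. Then (e: E1 → E0) is an object of Mon(ω,𝒢), the induced morphism (e: E1 → E0) → (t: T1 → T0) is componentwise surjective, and its componentwise kernel is isomorphic to the kernel of ψ; in particular pullbacks of admissible epics along arbitrary morphisms exist in Mon(ω,𝒢) and are admissible epics. -/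

import Mathlib

open CategoryTheory LinearMap Function

/-- A module `M` over a commutative ring `A` is *Gorenstein projective* if the biduality
map `M → Hom_A(Hom_A(M,A),A)` is an isomorphism and
`Ext^i_A(M,A) = 0 = Ext^i_A(Hom_A(M,A),A)` for all `i ≥ 1`. -/
noncomputable def IsGP (A : Type) [CommRing A] (M : Type) [AddCommGroup M] [Module A M] : Prop :=
  Function.Bijective (Module.Dual.eval A M) ∧
  (∀ i : ℕ, 0 < i →
    Subsingleton (((Ext A (ModuleCat A) i).obj
      (Opposite.op (ModuleCat.of A M))).obj (ModuleCat.of A A))) ∧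
  (∀ i : ℕ, 0 < i →
    Subsingleton (((Ext A (ModuleCat A) i).obj
      (Opposite.op (ModuleCat.of A (Module.Dual A M)))).obj (ModuleCat.of A A)))

/-- `f : G1 → G0` is an object of the monomorphism category `Mon(ω, 𝒢)`:
`G1`, `G0` are finitely generated Gorenstein projective `S`-modules, `f` is injective,
and `ω · Coker f = 0` (i.e. `ω • y ∈ range f` for all `y`). -/
def MonObj (S : Type) [CommRing S] (ω : S) {G1 G0 : Type}
    [AddCommGroup G1] [Module S G1] [AddCommGroup G0] [Module S G0]
    (f : G1 →ₗ[S] G0) : Prop :=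
  Module.Finite S G1 ∧ Module.Finite S G0 ∧ IsGP S G1 ∧ IsGP S G0 ∧
  Function.Injective f ∧ ∀ y : G0, ω • y ∈ LinearMap.range f

/-- The pullback of `ψ : G → H` and `θ : T → H`, as the submodule
`{(x, y) | ψ x = θ y}` of `G × T`, realized as `ker (ψ ⊕ (-θ))`. -/
abbrev pullbackMod {S : Type} [CommRing S] {G T H : Type}
    [AddCommGroup G] [Module S G] [AddCommGroup T] [Module S T]
    [AddCommGroup H] [Module S H] (ψ : G →ₗ[S] H) (θ : T →ₗ[S] H) :
    Submodule S (G × T) :=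
  LinearMap.ker (ψ.coprod (-θ))

/-- The second projection `G ×_H T → T` of the pullback. -/
noncomputable def pullbackSnd {S : Type} [CommRing S] {G T H : Type}
    [AddCommGroup G] [Module S G] [AddCommGroup T] [Module S T]
    [AddCommGroup H] [Module S H] (ψ : G →ₗ[S] H) (θ : T →ₗ[S] H) :
    pullbackMod ψ θ →ₗ[S] T :=
  (LinearMap.snd S G T) ∘ₗ (pullbackMod ψ θ).subtype

/-- The map induced between two pullbacks by a compatible triple of maps. -/
noncomputable def pullbackMap {S : Type} [CommRing S] {G1 G0 T1 T0 H1 H0 : Type}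
    [AddCommGroup G1] [Module S G1] [AddCommGroup G0] [Module S G0]
    [AddCommGroup T1] [Module S T1] [AddCommGroup T0] [Module S T0]
    [AddCommGroup H1] [Module S H1] [AddCommGroup H0] [Module S H0]
    (gm : G1 →ₗ[S] G0) (tm : T1 →ₗ[S] T0) (hm : H1 →ₗ[S] H0)
    (ψ1 : G1 →ₗ[S] H1) (ψ0 : G0 →ₗ[S] H0)
    (θ1 : T1 →ₗ[S] H1) (θ0 : T0 →ₗ[S] H0)
    (hψ : hm ∘ₗ ψ1 = ψ0 ∘ₗ gm) (hθ : hm ∘ₗ θ1 = θ0 ∘ₗ tm) :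
    pullbackMod ψ1 θ1 →ₗ[S] pullbackMod ψ0 θ0 :=
  (gm.prodMap tm).restrict (fun x hx => by
    have e1 := LinearMap.congr_fun hψ x.1
    have e2 := LinearMap.congr_fun hθ x.2
    simp only [LinearMap.comp_apply] at e1 e2
    simp only [pullbackMod, LinearMap.mem_ker, LinearMap.coprod_apply,
      LinearMap.neg_apply, LinearMap.prodMap_apply, Prod.map_fst, Prod.map_snd] at hx ⊢
    rw [← e1, ← e2, ← map_neg, ← map_add, hx, map_zero])

section Helpers

lemma subsingleton_ext_iff (A : Type) [CommRing A] (X Y : ModuleCat.{0} A) (i : ℕ) :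
    Subsingleton (((Ext A (ModuleCat A) (i+1)).obj (Opposite.op X)).obj Y) ↔
    Subsingleton (Abelian.Ext X Y (i+1)) := by
  let P := ProjectiveResolution.of X
  have h1 : Subsingleton (((Ext A (ModuleCat A) (i+1)).obj (Opposite.op X)).obj Y) ↔
      (P.complex.linearYonedaObj A Y).ExactAt (i+1) := by
    rw [HomologicalComplex.exactAt_iff_isZero_homology, ← (P.isoExt (i+1) Y).isZero_iff,
      ModuleCat.isZero_iff_subsingleton]
  have h2 : (P.complex.linearYonedaObj A Y).ExactAt (i+1) ↔
      ∀ f : P.complex.X (i+1) ⟶ Y, P.complex.d (i+2) (i+1) ≫ f = 0 →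
        ∃ g : P.complex.X i ⟶ Y, P.complex.d (i+1) i ≫ g = f := by
    rw [HomologicalComplex.exactAt_iff' _ i (i+1) (i+2) (by simp) (by simp),
      ShortComplex.moduleCat_exact_iff]
    exact Iff.rfl
  rw [h1, h2]
  constructor
  · intro h
    refine ⟨fun a b => ?_⟩
    have key : ∀ a : Abelian.Ext X Y (i+1), a = 0 := by
      intro a
      obtain ⟨f, hf, rfl⟩ := P.extMk_surjective a (i+2) rfl
      rw [P.extMk_eq_zero_iff f (i+2) rfl hf i rfl]
      exact h f hf
    rw [key a, key b]
  · intro h f hf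
    exact (P.extMk_eq_zero_iff f (i+2) rfl hf i rfl).1 (Subsingleton.elim _ _)

variable {A : Type} [CommRing A] {K E T : Type} [AddCommGroup K] [Module A K]
  [AddCommGroup E] [Module A E] [AddCommGroup T] [Module A T]

lemma shortExact_of (f : K →ₗ[A] E) (g : E →ₗ[A] T) (hf : Function.Injective f)
    (hg : Function.Surjective g) (hfg : Function.Exact f g) :
    (ShortComplex.mk (ModuleCat.ofHom f) (ModuleCat.ofHom g)
      (by ext x; simpa using hfg.apply_apply_eq_zero x)).ShortExact where
  exact := by
    rw [ShortComplex.moduleCat_exact_iff]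
    intro x hx
    exact (hfg x).1 hx
  mono_f := (ModuleCat.mono_iff_injective _).2 hf
  epi_g := (ModuleCat.epi_iff_surjective _).2 hg

lemma ext_extension (f : K →ₗ[A] E) (g : E →ₗ[A] T) (hf : Function.Injective f)
    (hg : Function.Surjective g) (hfg : Function.Exact f g) (i : ℕ)
    (hK : Subsingleton (((Ext A (ModuleCat A) i).obj
      (Opposite.op (ModuleCat.of A K))).obj (ModuleCat.of A A)))
    (hT : Subsingleton (((Ext A (ModuleCat A) i).obj
      (Opposite.op (ModuleCat.of A T))).obj (ModuleCat.of A A))) (hi : 0 < i) :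
    Subsingleton (((Ext A (ModuleCat A) i).obj
      (Opposite.op (ModuleCat.of A E))).obj (ModuleCat.of A A)) := by
  obtain ⟨i, rfl⟩ : ∃ j, i = j + 1 := ⟨i - 1, by omega⟩
  rw [subsingleton_ext_iff] at *
  have key : ∀ a : Abelian.Ext (ModuleCat.of A E) (ModuleCat.of A A) (i+1), a = 0 := by
    intro a
    obtain ⟨y, rfl⟩ := Abelian.Ext.contravariant_sequence_exact₂ (shortExact_of f g hf hg hfg)
      (ModuleCat.of A A) a (hK.elim _ _)
    rw [show y = 0 from hT.elim _ _]
    simp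
  exact ⟨fun a b => by rw [key a, key b]⟩

lemma dualMap_surj (f : K →ₗ[A] E) (g : E →ₗ[A] T) (hf : Function.Injective f)
    (hg : Function.Surjective g) (hfg : Function.Exact f g)
    (hT : Subsingleton (((Ext A (ModuleCat A) 1).obj
      (Opposite.op (ModuleCat.of A T))).obj (ModuleCat.of A A))) :
    Function.Surjective f.dualMap := by
  intro φ
  rw [subsingleton_ext_iff _ _ _ 0] at hT
  obtain ⟨y, hy⟩ := Abelian.Ext.contravariant_sequence_exact₁ (shortExact_of f g hf hg hfg)
      (ModuleCat.of A A) (Abelian.Ext.mk₀ (ModuleCat.ofHom φ)) (n₁ := 1) rfl (hT.elim _ _)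
  obtain ⟨y, rfl⟩ := Abelian.Ext.addEquiv₀.symm.surjective y
  refine ⟨y.hom, ?_⟩
  have : ModuleCat.ofHom f ≫ y = ModuleCat.ofHom φ := by
    apply Abelian.Ext.addEquiv₀.symm.injective
    simpa using hy
  ext x
  exact congrArg (fun h => h.hom x) this

lemma dualMap_exact (f : K →ₗ[A] E) (g : E →ₗ[A] T)
    (hg : Function.Surjective g) (hfg : Function.Exact f g) :
    Function.Exact g.dualMap f.dualMap := by
  intro φ
  constructor
  · intro h
    have hk : LinearMap.ker g ≤ LinearMap.ker φ := by
      intro x hx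
      obtain ⟨k, rfl⟩ := (hfg x).1 hx
      exact LinearMap.congr_fun h k
    refine ⟨((LinearMap.ker g).liftQ φ hk) ∘ₗ
      (g.quotKerEquivOfSurjective hg).symm.toLinearMap, ?_⟩
    ext x
    have : (g.quotKerEquivOfSurjective hg).symm (g x) = Submodule.Quotient.mk x := by
      rw [LinearEquiv.symm_apply_eq]; rfl
    simp [LinearMap.dualMap_apply, this]
  · rintro ⟨ψ, rfl⟩
    ext x
    simp [LinearMap.dualMap_apply, hfg.apply_apply_eq_zero x]

lemma IsGP.extension (f : K →ₗ[A] E) (g : E →ₗ[A] T) (hf : Function.Injective f)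
    (hg : Function.Surjective g) (hfg : Function.Exact f g)
    (hK : IsGP A K) (hT : IsGP A T) : IsGP A E := by
  have s1 := dualMap_surj f g hf hg hfg (hT.2.1 1 one_pos)
  have e1 := dualMap_exact f g hg hfg
  have i1 : Function.Injective g.dualMap := LinearMap.dualMap_injective_of_surjective hg
  have e2 := dualMap_exact _ _ s1 e1
  have s2 := dualMap_surj _ _ i1 s1 e1 (hK.2.2 1 one_pos)
  have i2 : Function.Injective f.dualMap.dualMap := LinearMap.dualMap_injective_of_surjective s1
  refine ⟨?_, fun i hi => ext_extension f g hf hg hfg i (hK.2.1 i hi) (hT.2.1 i hi) hi,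
    fun i hi => ext_extension _ _ i1 s1 e1 i (hT.2.2 i hi) (hK.2.2 i hi) hi⟩
  have nf : ∀ x, f.dualMap.dualMap (Module.Dual.eval A K x) = Module.Dual.eval A E (f x) :=
    fun x => rfl
  have ng : ∀ x, g.dualMap.dualMap (Module.Dual.eval A E x) = Module.Dual.eval A T (g x) :=
    fun x => rfl
  constructor
  · rw [injective_iff_map_eq_zero]
    intro x hx
    have h1 : g x = 0 := by
      apply hT.1.1
      rw [← ng, hx]; simp
    obtain ⟨k, rfl⟩ := (hfg x).1 h1
    rw [← nf] at hx
    have : k = 0 := by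
      apply hK.1.1
      apply i2
      rw [hx]; simp
    rw [this, map_zero]
  · intro ξ
    obtain ⟨t, ht⟩ := hT.1.2 (g.dualMap.dualMap ξ)
    obtain ⟨x, rfl⟩ := hg t
    have : g.dualMap.dualMap (ξ - Module.Dual.eval A E x) = 0 := by
      rw [map_sub, ng, ht, sub_self]
    obtain ⟨η, hη⟩ := (e2 _).1 this
    obtain ⟨k, rfl⟩ := hK.1.2 η
    refine ⟨f k + x, ?_⟩
    rw [map_add, ← nf, hη, sub_add_cancel]

lemma isGP_of_subsingleton [Subsingleton T] : IsGP A T := by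
  have ss : ∀ (M : Type) [AddCommGroup M] [Module A M] [Subsingleton M] (i : ℕ), 0 < i →
    Subsingleton (((Ext A (ModuleCat A) i).obj
      (Opposite.op (ModuleCat.of A M))).obj (ModuleCat.of A A)) := by
    intro M _ _ _ i hi
    obtain ⟨i, rfl⟩ : ∃ j, i = j + 1 := ⟨i - 1, by omega⟩
    have : Projective (ModuleCat.of A M) := ModuleCat.projective_of_free (ι := Empty)
      (Module.Basis.empty M)
    rw [← ModuleCat.isZero_iff_subsingleton]
    exact isZero_Ext_succ_of_projective _ _ _
  have : Subsingleton (Module.Dual A T) := ⟨fun a b => by ext x; simp [Subsingleton.elim x 0]⟩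
  have : Subsingleton (Module.Dual A (Module.Dual A T)) :=
    ⟨fun a b => by ext x; simp [Subsingleton.elim x 0]⟩
  exact ⟨⟨fun _ _ _ => Subsingleton.elim _ _, fun y => ⟨0, Subsingleton.elim _ _⟩⟩,
    fun i hi => ss _ i hi, fun i hi => ss _ i hi⟩

lemma IsGP.of_equiv (e : K ≃ₗ[A] E) (hK : IsGP A K) : IsGP A E :=
  IsGP.extension (T := PUnit) e.toLinearMap 0 e.injective (fun y => ⟨0, rfl⟩)
    (fun x => ⟨fun _ => e.surjective x, fun _ => rfl⟩) hK isGP_of_subsingleton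

/-- The kernel of the second projection of a pullback is the kernel of `ψ`. -/
noncomputable def kerEquiv {G T H : Type}
    [AddCommGroup G] [Module A G] [AddCommGroup T] [Module A T]
    [AddCommGroup H] [Module A H] (ψ : G →ₗ[A] H) (θ : T →ₗ[A] H) :
    LinearMap.ker (pullbackSnd ψ θ) ≃ₗ[A] LinearMap.ker ψ where
  toFun z := ⟨z.1.1.1, by
    have h1 : ψ z.1.1.1 + -θ z.1.1.2 = 0 := z.1.2
    have h2 : z.1.1.2 = 0 := z.2
    rw [h2] at h1
    simpa using h1⟩
  map_add' _ _ := rfl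
  map_smul' _ _ := rfl
  invFun x := ⟨⟨(x.1, 0), by
    have : ψ x.1 = 0 := x.2
    simp [this]⟩, rfl⟩
  left_inv z := by
    have h2 : z.1.1.2 = 0 := z.2
    apply Subtype.ext
    apply Subtype.ext
    exact Prod.ext rfl h2.symm
  right_inv _ := rfl

lemma pullbackSnd_surj {G T H : Type}
    [AddCommGroup G] [Module A G] [AddCommGroup T] [Module A T]
    [AddCommGroup H] [Module A H] (ψ : G →ₗ[A] H) (θ : T →ₗ[A] H)
    (hψ : Function.Surjective ψ) : Function.Surjective (pullbackSnd ψ θ) := by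
  intro t
  obtain ⟨x, hx⟩ := hψ (θ t)
  exact ⟨⟨(x, t), by simp [hx]⟩, rfl⟩

lemma isGP_pullback {G T H : Type}
    [AddCommGroup G] [Module A G] [AddCommGroup T] [Module A T]
    [AddCommGroup H] [Module A H] (ψ : G →ₗ[A] H) (θ : T →ₗ[A] H)
    (hψ : Function.Surjective ψ) (hK : IsGP A (LinearMap.ker ψ)) (hT : IsGP A T) :
    IsGP A (pullbackMod ψ θ) :=
  IsGP.extension (LinearMap.ker (pullbackSnd ψ θ)).subtype (pullbackSnd ψ θ)
    (Submodule.injective_subtype _) (pullbackSnd_surj ψ θ hψ)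
    (LinearMap.exact_subtype_ker_map _) (IsGP.of_equiv (E := LinearMap.ker (pullbackSnd ψ θ)) (kerEquiv ψ θ).symm hK) hT

end Helpers

/-- the pullback of an admissible epic `ψ : (gm : G1 → G0) → (hm : H1 → H0)`
in `Mon(ω, 𝒢)` along an arbitrary morphism `θ : (tm : T1 → T0) → (hm : H1 → H0)` exists
and is an admissible epic, with kernel isomorphic to the kernel of `ψ`. -/
theorem stmt_16 (S : Type) [CommRing S] [IsNoetherianRing S] [IsLocalRing S]
    (ω : S) (hω : ω ∈ IsLocalRing.maximalIdeal S) (hreg : ω ∈ nonZeroDivisors S)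
    (G1 G0 T1 T0 H1 H0 : Type)
    [AddCommGroup G1] [Module S G1] [AddCommGroup G0] [Module S G0]
    [AddCommGroup T1] [Module S T1] [AddCommGroup T0] [Module S T0]
    [AddCommGroup H1] [Module S H1] [AddCommGroup H0] [Module S H0]
    (gm : G1 →ₗ[S] G0) (tm : T1 →ₗ[S] T0) (hm : H1 →ₗ[S] H0)
    (hG : MonObj S ω gm) (hT : MonObj S ω tm) (hH : MonObj S ω hm)
    (ψ1 : G1 →ₗ[S] H1) (ψ0 : G0 →ₗ[S] H0)
    (hψ : hm ∘ₗ ψ1 = ψ0 ∘ₗ gm)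
    (hψ1 : Function.Surjective ψ1) (hψ0 : Function.Surjective ψ0)
    (hψker : MonObj S ω
      (gm.restrict (p := LinearMap.ker ψ1) (q := LinearMap.ker ψ0) (fun x hx => by
        have e := LinearMap.congr_fun hψ x
        simp only [LinearMap.comp_apply] at e
        simp only [LinearMap.mem_ker] at hx ⊢
        rw [← e, hx, map_zero])))
    (θ1 : T1 →ₗ[S] H1) (θ0 : T0 →ₗ[S] H0)
    (hθ : hm ∘ₗ θ1 = θ0 ∘ₗ tm) :
    MonObj S ω (pullbackMap gm tm hm ψ1 ψ0 θ1 θ0 hψ hθ) ∧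
    tm ∘ₗ pullbackSnd ψ1 θ1 =
      pullbackSnd ψ0 θ0 ∘ₗ pullbackMap gm tm hm ψ1 ψ0 θ1 θ0 hψ hθ ∧
    Function.Surjective (pullbackSnd ψ1 θ1) ∧
    Function.Surjective (pullbackSnd ψ0 θ0) ∧
    ∃ hker : ∀ z ∈ LinearMap.ker (pullbackSnd ψ1 θ1),
        pullbackMap gm tm hm ψ1 ψ0 θ1 θ0 hψ hθ z ∈ LinearMap.ker (pullbackSnd ψ0 θ0),
      MonObj (G1 := LinearMap.ker (pullbackSnd ψ1 θ1))
        (G0 := LinearMap.ker (pullbackSnd ψ0 θ0)) S ω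
        ((pullbackMap gm tm hm ψ1 ψ0 θ1 θ0 hψ hθ).restrict
          (p := LinearMap.ker (pullbackSnd ψ1 θ1))
          (q := LinearMap.ker (pullbackSnd ψ0 θ0)) hker) ∧
      ∃ (k1 : LinearMap.ker (pullbackSnd ψ1 θ1) ≃ₗ[S] LinearMap.ker ψ1)
        (k0 : LinearMap.ker (pullbackSnd ψ0 θ0) ≃ₗ[S] LinearMap.ker ψ0),
        (gm.restrict (p := LinearMap.ker ψ1) (q := LinearMap.ker ψ0) (fun x hx => by
            have e := LinearMap.congr_fun hψ x
            simp only [LinearMap.comp_apply] at e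
            simp only [LinearMap.mem_ker] at hx ⊢
            rw [← e, hx, map_zero])) ∘ₗ (k1 : _ →ₗ[S] _) =
          (k0 : _ →ₗ[S] _) ∘ₗ ((pullbackMap gm tm hm ψ1 ψ0 θ1 θ0 hψ hθ).restrict
            (p := LinearMap.ker (pullbackSnd ψ1 θ1)) (q := LinearMap.ker (pullbackSnd ψ0 θ0)) hker) := by
  obtain ⟨fG1, fG0, -, -, iG, wG⟩ := hG
  obtain ⟨fT1, fT0, gT1, gT0, iT, wT⟩ := hT
  obtain ⟨-, -, -, -, iH, wH⟩ := hH
  obtain ⟨fK1, fK0, gK1, gK0, iK, wK⟩ := hψker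
  have hker : ∀ z ∈ LinearMap.ker (pullbackSnd ψ1 θ1),
      pullbackMap gm tm hm ψ1 ψ0 θ1 θ0 hψ hθ z ∈ LinearMap.ker (pullbackSnd ψ0 θ0) := by
    intro z hz
    have h2 : z.1.2 = 0 := hz
    change tm z.1.2 = 0
    rw [h2, map_zero]
  have inj : Function.Injective (pullbackMap gm tm hm ψ1 ψ0 θ1 θ0 hψ hθ) := by
    intro a b hab
    have h := congrArg Subtype.val hab
    have h1 : gm a.1.1 = gm b.1.1 := congrArg Prod.fst h
    have h2 : tm a.1.2 = tm b.1.2 := congrArg Prod.snd h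
    exact Subtype.ext (Prod.ext (iG h1) (iT h2))
  refine ⟨⟨inferInstance, inferInstance, isGP_pullback _ _ hψ1 gK1 gT1,
    isGP_pullback _ _ hψ0 gK0 gT0, inj, ?_⟩, rfl, pullbackSnd_surj _ _ hψ1,
    pullbackSnd_surj _ _ hψ0, hker, ⟨inferInstance, inferInstance,
      gK1.of_equiv (kerEquiv ψ1 θ1).symm, gK0.of_equiv (kerEquiv ψ0 θ0).symm, ?_, ?_⟩,
    kerEquiv ψ1 θ1, kerEquiv ψ0 θ0, rfl⟩
  · rintro ⟨⟨x, t⟩, hxt⟩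
    have hxt' : ψ0 x = θ0 t := by
      have h1 : ψ0 x + -θ0 t = 0 := hxt
      exact add_neg_eq_zero.1 h1
    obtain ⟨x', hx'⟩ := wG x
    obtain ⟨t', ht'⟩ := wT t
    have e1 : hm (ψ1 x') = ψ0 (gm x') := LinearMap.congr_fun hψ x'
    have e2 : hm (θ1 t') = θ0 (tm t') := LinearMap.congr_fun hθ t'
    have : ψ1 x' = θ1 t' := by
      apply iH
      rw [e1, e2, hx', ht', map_smul, map_smul, hxt']
    exact ⟨⟨(x', t'), by simp [this]⟩, Subtype.ext (Prod.ext hx' ht')⟩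
  · intro a b hab
    exact Subtype.ext (inj (congrArg Subtype.val hab))
  · intro y
    obtain ⟨k, hk⟩ := wK (kerEquiv ψ0 θ0 y)
    refine ⟨(kerEquiv ψ1 θ1).symm k, (kerEquiv ψ0 θ0).injective ?_⟩
    rw [map_smul, ← hk]
    rfl
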